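/- For two weighted compact real trees (X, d_X, ν_X) and (Y, d_Y, ν_Y), one has Δ_GHwt((X,d_X,ν_X),(Y,d_Y,ν_Y)) = 0 if and only if (X,d_X,ν_X) and (Y,d_Y,ν_Y) are weight-preserving isometric, i.e., there exists a surjective isometry φ : X → Y with φ_*ν_X = ν_Y. -/

import Mathlib

open MeasureTheory Metric Set

/-- The four point condition for a distance function. -/
def FourPoint {X : Type*} (d : X → X → ℝ) : Prop :=
  ∀ x₁ x₂ x₃ x₄ : X, d x₁ x₂ + d x₃ x₄ ≤ max (d x₁ x₃ + d x₂ x₄) (d x₁ x₄ + d x₂ x₃)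

/-- A real tree: a metric space which is complete, path-connected and satisfies
the four point condition. -/
def IsRealTree (X : Type*) [MetricSpace X] : Prop :=
  CompleteSpace X ∧ PathConnectedSpace X ∧ FourPoint (fun x y : X => dist x y)

/-- `dis(f) ≤ ε`: the distortion of `f` is at most `ε`. -/
def DistortionLE {X Y : Type*} [MetricSpace X] [MetricSpace Y] (f : X → Y) (ε : ℝ) : Prop :=
  ∀ x₁ x₂ : X, |dist x₁ x₂ - dist (f x₁) (f x₂)| ≤ ε

/-- `f` is an `ε`-isometry: it has distortion at most `ε` and its range is an `ε`-net. -/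
def IsEpsIsometry {X Y : Type*} [MetricSpace X] [MetricSpace Y] (f : X → Y) (ε : ℝ) : Prop :=
  DistortionLE f ε ∧ ∀ y : Y, ∃ x : X, dist y (f x) ≤ ε

/-- The Prohorov distance between two Borel measures. -/
noncomputable def prohorovDist {X : Type*} [MetricSpace X] [MeasurableSpace X]
    (μ ν : Measure X) : ℝ :=
  sInf {ε : ℝ | 0 < ε ∧ ∀ C : Set X, IsClosed C →
    μ C ≤ ν (Metric.thickening ε C) + ENNReal.ofReal ε}

/-- `Δ_GHwt` between two weighted metric spaces: the infimum of all `ε > 0` such that there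
exist Borel measurable `ε`-isometries `f : X → Y` and `g : Y → X` with
`d_P(f_*ν_X, ν_Y) ≤ ε` and `d_P(ν_X, g_*ν_Y) ≤ ε`. -/
noncomputable def DeltaGHwt (X Y : Type*) [MetricSpace X] [MeasurableSpace X]
    [MetricSpace Y] [MeasurableSpace Y] (νX : Measure X) (νY : Measure Y) : ℝ :=
  sInf {ε : ℝ | 0 < ε ∧
    (∃ f : X → Y, Measurable f ∧ IsEpsIsometry f ε ∧ prohorovDist (νX.map f) νY ≤ ε) ∧
    (∃ g : Y → X, Measurable g ∧ IsEpsIsometry g ε ∧ prohorovDist νX (νY.map g) ≤ ε)}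

open scoped Topology ENNReal

theorem prohorov_set_nonempty {X : Type*} [MetricSpace X] [MeasurableSpace X]
    (μ ν : Measure X) [IsProbabilityMeasure μ] :
    (1 : ℝ) ∈ {ε : ℝ | 0 < ε ∧ ∀ C : Set X, IsClosed C →
      μ C ≤ ν (Metric.thickening ε C) + ENNReal.ofReal ε} := by
  refine ⟨one_pos, fun C _ => ?_⟩
  rw [ENNReal.ofReal_one]
  exact prob_le_one.trans le_add_self

theorem prohorov_bddBelow {X : Type*} [MetricSpace X] [MeasurableSpace X]
    (μ ν : Measure X) :
    BddBelow {ε : ℝ | 0 < ε ∧ ∀ C : Set X, IsClosed C →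
      μ C ≤ ν (Metric.thickening ε C) + ENNReal.ofReal ε} :=
  ⟨0, fun _ h => h.1.le⟩

theorem prohorov_le_one {X : Type*} [MetricSpace X] [MeasurableSpace X]
    (μ ν : Measure X) [IsProbabilityMeasure μ] : prohorovDist μ ν ≤ 1 :=
  csInf_le (prohorov_bddBelow μ ν) (prohorov_set_nonempty μ ν)

theorem prohorov_self_le {X : Type*} [MetricSpace X] [MeasurableSpace X]
    (μ : Measure X) {ε : ℝ} (hε : 0 < ε) : prohorovDist μ μ ≤ ε :=
  csInf_le (prohorov_bddBelow μ μ)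
    ⟨hε, fun C _ => (measure_mono (self_subset_thickening hε C)).trans le_self_add⟩

theorem prohorov_spec {X : Type*} [MetricSpace X] [MeasurableSpace X]
    (μ ν : Measure X) [IsProbabilityMeasure μ] {ε : ℝ} (h : prohorovDist μ ν < ε)
    (C : Set X) (hC : IsClosed C) :
    μ C ≤ ν (Metric.thickening ε C) + ENNReal.ofReal ε := by
  obtain ⟨e, ⟨he, he2⟩, hlt⟩ := exists_lt_of_csInf_lt ⟨1, prohorov_set_nonempty μ ν⟩ h
  refine (he2 C hC).trans ?_
  gcongr

theorem eq_of_le_closed {Y : Type*} [MetricSpace Y] [MeasurableSpace Y] [BorelSpace Y]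
    (μ ν : Measure Y) [IsProbabilityMeasure μ] [IsProbabilityMeasure ν]
    (h : ∀ C : Set Y, IsClosed C → μ C ≤ ν C) : μ = ν := by
  have key : ∀ C : Set Y, IsClosed C → ν C ≤ μ C := by
    intro C hC
    have ht : Filter.Tendsto (fun r => μ (thickening r C)) (𝓝[>] 0) (𝓝 (μ C)) :=
      tendsto_measure_thickening_of_isClosed ⟨1, one_pos, measure_ne_top _ _⟩ hC
    refine ge_of_tendsto ht ?_
    filter_upwards [self_mem_nhdsWithin] with r hr
    refine (measure_mono (self_subset_thickening hr C)).trans ?_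
    have h1 := h (thickening r C)ᶜ isOpen_thickening.isClosed_compl
    have hm : MeasurableSet (thickening r C) := isOpen_thickening.measurableSet
    have e1 := prob_add_prob_compl (μ := μ) hm
    have e2 := prob_add_prob_compl (μ := ν) hm
    have : ν (thickening r C) + μ (thickening r C)ᶜ
        ≤ μ (thickening r C) + μ (thickening r C)ᶜ := by
      rw [e1, ← e2]; gcongr
    exact (ENNReal.add_le_add_iff_right (measure_ne_top _ _)).1 this
  refine ext_of_generate_finite {C : Set Y | IsClosed C} ?_ isPiSystem_isClosed ?_ ?_
  · rw [BorelSpace.measurable_eq (α := Y), borel_eq_generateFrom_isClosed]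
  · exact fun C hC => le_antisymm (h C hC) (key C hC)
  · simp

theorem exists_iso_of_approx {X Y : Type*} [MetricSpace X] [CompactSpace X]
    [MetricSpace Y] [CompactSpace Y] (f : ℕ → X → Y) (e : ℕ → ℝ)
    (he : Filter.Tendsto e Filter.atTop (𝓝 0))
    (hf : ∀ n, IsEpsIsometry (f n) (e n)) :
    ∃ φ : X → Y, Isometry φ ∧ Function.Surjective φ ∧
      ∀ δ > 0, ∀ N : ℕ, ∃ n ≥ N, ∀ x, dist (f n x) (φ x) ≤ δ := by
  set U : Ultrafilter ℕ := Filter.hyperfilter ℕ with hU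
  have hUle : (U : Filter ℕ) ≤ Filter.atTop := by
    rw [← Nat.cofinite_eq_atTop]; exact Filter.hyperfilter_le_cofinite
  have heU := he.mono_left hUle
  have limY : ∀ u : ℕ → Y, ∃ y, Filter.Tendsto u U (𝓝 y) := by
    intro u
    obtain ⟨y, -, hy⟩ := isCompact_univ.ultrafilter_le_nhds (U.map u) (by simp)
    exact ⟨y, hy⟩
  have limX : ∀ u : ℕ → X, ∃ y, Filter.Tendsto u U (𝓝 y) := by
    intro u
    obtain ⟨y, -, hy⟩ := isCompact_univ.ultrafilter_le_nhds (U.map u) (by simp)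
    exact ⟨y, hy⟩
  choose φ hφ using fun x => limY (fun n => f n x)
  have hiso : Isometry φ := by
    refine Isometry.of_dist_eq fun x y => ?_
    have h1 : Filter.Tendsto (fun n => dist (f n x) (f n y)) U (𝓝 (dist (φ x) (φ y))) :=
      (hφ x).dist (hφ y)
    have h2 : Filter.Tendsto (fun n => dist x y - dist (f n x) (f n y)) U (𝓝 0) :=
      squeeze_zero_norm (fun n => (hf n).1 x y) heU
    have h3 := h1.const_sub (dist x y)
    have := tendsto_nhds_unique h2 h3
    linarith
  have hmove : ∀ (u : ℕ → X) (x : X), Filter.Tendsto u U (𝓝 x) →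
      Filter.Tendsto (fun n => f n (u n)) U (𝓝 (φ x)) := by
    intro u x hu
    have hd : Filter.Tendsto (fun n => dist (f n x) (f n (u n))) U (𝓝 0) := by
      have h0 : Filter.Tendsto (fun n => dist x (u n) + e n) U (𝓝 0) := by
        have := ((tendsto_const_nhds (x := x)).dist hu).add heU
        simpa using this
      refine squeeze_zero (fun n => dist_nonneg) (fun n => ?_) h0
      have := (abs_le.1 ((hf n).1 x (u n))).1
      linarith
    exact (tendsto_iff_of_dist hd).1 (hφ x)
  refine ⟨φ, hiso, ?_, ?_⟩
  · intro y
    choose u hu using fun n => (hf n).2 y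
    obtain ⟨x, hx⟩ := limX u
    refine ⟨x, tendsto_nhds_unique (hmove u x hx) ?_⟩
    rw [tendsto_iff_dist_tendsto_zero]
    refine squeeze_zero (fun n => dist_nonneg) (fun n => ?_) heU
    rw [dist_comm]; exact hu n
  · intro δ hδ N
    by_contra! hcon
    have : ∀ n, ∃ x, N ≤ n → δ < dist (f n x) (φ x) := by
      intro n
      by_cases hn : N ≤ n
      · obtain ⟨x, hx⟩ := hcon n hn
        exact ⟨x, fun _ => hx⟩
      · obtain ⟨x, -⟩ := hcon N le_rfl
        exact ⟨x, fun h => absurd h hn⟩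
    choose u hu using this
    obtain ⟨x, hx⟩ := limX u
    have h1 := (hmove u x hx).dist ((hiso.continuous.tendsto x).comp hx)
    rw [dist_self] at h1
    have h2 := h1.eventually (gt_mem_nhds hδ)
    have h3 := hUle (Filter.eventually_ge_atTop N)
    obtain ⟨n, hn1, hn2⟩ := (h2.and h3).exists
    exact absurd (hu n hn2) (not_lt.2 (le_of_lt hn1))

theorem const_eps {X Y : Type*} [MetricSpace X] [CompactSpace X]
    [MetricSpace Y] [CompactSpace Y] (y₀ : Y) [Nonempty X] {ε : ℝ}
    (h1 : diam (univ : Set X) ≤ ε) (h2 : diam (univ : Set Y) ≤ ε) :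
    IsEpsIsometry (fun _ : X => y₀) ε := by
  refine ⟨fun a b => ?_, fun y => ⟨Classical.arbitrary X, ?_⟩⟩
  · rw [dist_self, sub_zero, abs_of_nonneg dist_nonneg]
    exact (dist_le_diam_of_mem isCompact_univ.isBounded (mem_univ a) (mem_univ b)).trans h1
  · exact (dist_le_diam_of_mem isCompact_univ.isBounded (mem_univ _) (mem_univ _)).trans h2

theorem iso_eps {X Y : Type*} [MetricSpace X] [MetricSpace Y] {f : X → Y}
    (h : Isometry f) (hs : Function.Surjective f) {ε : ℝ} (hε : 0 < ε) :
    IsEpsIsometry f ε := by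
  refine ⟨fun a b => ?_, fun y => ?_⟩
  · rw [h.dist_eq, sub_self, abs_zero]; exact hε.le
  · obtain ⟨x, rfl⟩ := hs y
    exact ⟨x, by rw [dist_self]; exact hε.le⟩

/-- `Δ_GHwt` vanishes between two weighted compact real trees if and only if they are
weight-preserving isometric. -/
theorem deltaGHwt_eq_zero_iff_wpIsometric
    (X Y : Type*) [MetricSpace X] [CompactSpace X] [Nonempty X]
    [MeasurableSpace X] [BorelSpace X]
    [MetricSpace Y] [CompactSpace Y] [Nonempty Y]
    [MeasurableSpace Y] [BorelSpace Y]
    (hX : IsRealTree X) (hY : IsRealTree Y)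
    (νX : Measure X) (νY : Measure Y)
    [IsProbabilityMeasure νX] [IsProbabilityMeasure νY] :
    DeltaGHwt X Y νX νY = 0 ↔
      ∃ φ : X → Y, Isometry φ ∧ Function.Surjective φ ∧ νX.map φ = νY := by
  constructor
  · intro h0
    have hne : {ε : ℝ | 0 < ε ∧
      (∃ f : X → Y, Measurable f ∧ IsEpsIsometry f ε ∧ prohorovDist (νX.map f) νY ≤ ε) ∧
      (∃ g : Y → X, Measurable g ∧ IsEpsIsometry g ε ∧
        prohorovDist νX (νY.map g) ≤ ε)}.Nonempty := by
      refine ⟨max 1 (max (diam (univ : Set X)) (diam (univ : Set Y))), by positivity,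
        ⟨fun _ => Classical.arbitrary Y, measurable_const, const_eps _ (by simp) (by simp), ?_⟩,
        ⟨fun _ => Classical.arbitrary X, measurable_const, const_eps _ (by simp) (by simp), ?_⟩⟩
      · haveI := Measure.isProbabilityMeasure_map (μ := νX)
          (f := fun _ : X => Classical.arbitrary Y) measurable_const.aemeasurable
        exact (prohorov_le_one _ _).trans (le_max_left _ _)
      · exact (prohorov_le_one _ _).trans (le_max_left _ _)
    have hex : ∀ n : ℕ, ∃ f : X → Y, Measurable f ∧ IsEpsIsometry f (1 / ((n : ℝ) + 1)) ∧
        prohorovDist (νX.map f) νY < 1 / ((n : ℝ) + 1) := by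
      intro n
      have hpos : (0 : ℝ) < 1 / ((n : ℝ) + 1) := by positivity
      obtain ⟨ε, ⟨_, ⟨f, hfm, hfi, hfp⟩, _⟩, hlt⟩ :=
        exists_lt_of_csInf_lt hne (lt_of_eq_of_lt h0 hpos)
      refine ⟨f, hfm, ⟨fun a b => (hfi.1 a b).trans hlt.le, fun y => ?_⟩, hfp.trans_lt hlt⟩
      obtain ⟨x, hx⟩ := hfi.2 y
      exact ⟨x, hx.trans hlt.le⟩
    choose f hfm hfi hfp using hex
    obtain ⟨φ, hiso, hsurj, happ⟩ := exists_iso_of_approx f _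
      tendsto_one_div_add_atTop_nhds_zero_nat hfi
    refine ⟨φ, hiso, hsurj, ?_⟩
    have hφm : Measurable φ := hiso.continuous.measurable
    haveI := Measure.isProbabilityMeasure_map (μ := νX) hφm.aemeasurable
    refine eq_of_le_closed _ _ fun C hC => ?_
    have hmain : ∀ δ : ℝ, 0 < δ →
        νX.map φ C ≤ νY (cthickening (δ + δ) C) + ENNReal.ofReal δ := by
      intro δ hδ
      obtain ⟨N, hN⟩ := exists_nat_one_div_lt hδ
      obtain ⟨n, hn, hfn⟩ := happ δ hδ N
      have hnδ : 1 / ((n : ℝ) + 1) < δ := lt_of_le_of_lt (by gcongr) hN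
      haveI := Measure.isProbabilityMeasure_map (μ := νX) (hfm n).aemeasurable
      have hp := prohorov_spec _ _ ((hfp n).trans hnδ) (cthickening δ C) isClosed_cthickening
      rw [Measure.map_apply (hfm n) isClosed_cthickening.measurableSet] at hp
      rw [Measure.map_apply hφm hC.measurableSet]
      have hsub : φ ⁻¹' C ⊆ f n ⁻¹' cthickening δ C := fun x hx =>
        mem_cthickening_of_dist_le _ (φ x) _ _ hx (hfn x)
      refine (measure_mono hsub).trans (hp.trans ?_)
      gcongr
      exact (thickening_subset_cthickening _ _).trans
        (cthickening_cthickening_subset hδ.le hδ.le C)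
    have ht : Filter.Tendsto (fun r => νY (cthickening r C)) (𝓝 0) (𝓝 (νY C)) :=
      tendsto_measure_cthickening_of_isClosed ⟨1, one_pos, measure_ne_top _ _⟩ hC
    have hd : Filter.Tendsto (fun δ : ℝ => δ + δ) (𝓝[>] 0) (𝓝 0) := by
      have : Filter.Tendsto (fun δ : ℝ => δ + δ) (𝓝 0) (𝓝 (0 + 0)) :=
        Filter.tendsto_id.add Filter.tendsto_id
      rw [add_zero] at this
      exact this.mono_left nhdsWithin_le_nhds
    have ho : Filter.Tendsto (fun δ : ℝ => ENNReal.ofReal δ) (𝓝[>] 0) (𝓝 0) := by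
      have := (ENNReal.continuous_ofReal.tendsto 0).mono_left
        (nhdsWithin_le_nhds (s := Ioi (0 : ℝ)))
      simpa using this
    have hlim := (ht.comp hd).add ho
    rw [add_zero] at hlim
    refine ge_of_tendsto hlim ?_
    filter_upwards [self_mem_nhdsWithin] with δ hδ
    exact hmain δ hδ
  · rintro ⟨φ, hiso, hsurj, hmap⟩
    have hφm : Measurable φ := hiso.continuous.measurable
    obtain ⟨g, hg⟩ := hsurj.hasRightInverse
    have hgi : Isometry g := hiso.right_inv hg
    have hgm : Measurable g := hgi.continuous.measurable
    have hgφ : ∀ x, g (φ x) = x := fun x => hiso.injective (hg (φ x))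
    have hgs : Function.Surjective g := fun x => ⟨φ x, hgφ x⟩
    have hmapg : νY.map g = νX := by
      rw [← hmap, Measure.map_map hgm hφm]
      have : g ∘ φ = id := funext hgφ
      rw [this, Measure.map_id]
    have hmem : ∀ ε : ℝ, 0 < ε → DeltaGHwt X Y νX νY ≤ ε := by
      intro ε hε
      refine csInf_le ⟨0, fun _ h => h.1.le⟩ ⟨hε,
        ⟨φ, hφm, iso_eps hiso hsurj hε, ?_⟩, ⟨g, hgm, iso_eps hgi hgs hε, ?_⟩⟩
      · rw [hmap]; exact prohorov_self_le _ hε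
      · rw [hmapg]; exact prohorov_self_le _ hε
    refine le_antisymm (le_of_forall_pos_le_add fun ε hε => ?_) ?_
    · rw [zero_add]; exact hmem ε hε
    · exact Real.sInf_nonneg fun _ h => h.1.le
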